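/- arXiv:1106.2066 — 3 statements merged into one kernel-verified Lean document; each statement's English description precedes it below -/
import Mathlib

section
/- Let V be a finite-dimensional real inner product space, let Q be the quadratic form on V given by Q(x) = -‖x‖², and let (e_1, …, e_n) be an orthonormal basis of V. For every symmetric linear endomorphism A of V and every vector v ∈ V, the following identity holds in the Clifford algebra of Q: ∑_{i=1}^n ι(e_i) * ι(v) * ι(A e_i) = (trace of A) • ι(v) - 2 • ι(A v). -/
open scoped RealInnerProductSpace

section NegDefinite

variable {V : Type*} [NormedAddCommGroup V] [InnerProductSpace ℝ V] {Q : QuadraticForm ℝ V}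

theorem polar_eq_neg_two_mul_inner (hQ : ∀ x, Q x = -‖x‖ ^ 2) (x y : V) :
    QuadraticMap.polar Q x y = -2 * ⟪x, y⟫ := by
  rw [QuadraticMap.polar, hQ, hQ, hQ, norm_add_sq_real]
  ring

theorem ι_mul_ι_add_swap_eq_inner_smul (hQ : ∀ x, Q x = -‖x‖ ^ 2) (x y : V) :
    CliffordAlgebra.ι Q x * CliffordAlgebra.ι Q y + CliffordAlgebra.ι Q y * CliffordAlgebra.ι Q x =
      (-2 * ⟪x, y⟫) • (1 : CliffordAlgebra Q) := by
  rw [CliffordAlgebra.ι_mul_ι_add_swap, polar_eq_neg_two_mul_inner hQ,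
    Algebra.algebraMap_eq_smul_one]

/-- A symmetric endomorphism can be moved across the contraction of a bilinear map
with an orthonormal basis. -/
theorem OrthonormalBasis.sum_bilin_apply_symmetric {ι M : Type*} [Fintype ι] [AddCommGroup M]
    [Module ℝ M] (b : OrthonormalBasis ι ℝ V) (A : V →ₗ[ℝ] V)
    (hA : ∀ x y, ⟪A x, y⟫ = ⟪x, A y⟫) (B : V →ₗ[ℝ] V →ₗ[ℝ] M) :
    ∑ i, B (A (b i)) (b i) = ∑ i, B (b i) (A (b i)) := by
  have left (i : ι) : B (A (b i)) (b i) = ∑ j, ⟪b j, A (b i)⟫ • B (b j) (b i) := by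
    conv_lhs => rw [← b.sum_repr' (A (b i))]
    simp
  have right (i : ι) : B (b i) (A (b i)) = ∑ j, ⟪b j, A (b i)⟫ • B (b i) (b j) := by
    conv_lhs => rw [← b.sum_repr' (A (b i))]
    simp
  simp_rw [left, right]
  rw [Finset.sum_comm]
  refine Finset.sum_congr rfl fun i _ => Finset.sum_congr rfl fun j _ => ?_
  rw [← hA, real_inner_comm]

theorem sum_ι_mul_ι_apply_symmetric {ι : Type*} [Fintype ι] (hQ : ∀ x, Q x = -‖x‖ ^ 2)
    (b : OrthonormalBasis ι ℝ V) (A : V →ₗ[ℝ] V) (hA : ∀ x y, ⟪A x, y⟫ = ⟪x, A y⟫) :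
    ∑ i, CliffordAlgebra.ι Q (b i) * CliffordAlgebra.ι Q (A (b i)) =
      -(LinearMap.trace ℝ V A • (1 : CliffordAlgebra Q)) := by
  have swap : ∑ i, CliffordAlgebra.ι Q (A (b i)) * CliffordAlgebra.ι Q (b i) =
      ∑ i, CliffordAlgebra.ι Q (b i) * CliffordAlgebra.ι Q (A (b i)) :=
    b.sum_bilin_apply_symmetric A hA
      ((LinearMap.mul ℝ (CliffordAlgebra Q)).compl₁₂ (CliffordAlgebra.ι Q) (CliffordAlgebra.ι Q))
  have anticomm := Finset.sum_congr (rfl : Finset.univ = Finset.univ) fun i _ =>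
    ι_mul_ι_add_swap_eq_inner_smul hQ (b i) (A (b i))
  rw [Finset.sum_add_distrib, swap, ← Finset.sum_smul, ← Finset.mul_sum,
    ← A.trace_eq_sum_inner b] at anticomm
  refine smul_right_injective _ (two_ne_zero (α := ℝ)) ?_
  simp only [two_smul ℝ (Finset.sum _ _), anticomm]
  module

end NegDefinite

/-- For a symmetric endomorphism `A` and a vector `v`,
`∑ i, e_i · v · A(e_i) = tr(A) • v - 2 • A(v)` in the Clifford algebra of
`Q(x) = -‖x‖²`. -/
theorem clifford_contraction_symmetric_with_vector
    {V : Type*} [NormedAddCommGroup V] [InnerProductSpace ℝ V] [FiniteDimensional ℝ V]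
    {n : ℕ} (b : OrthonormalBasis (Fin n) ℝ V)
    (Q : QuadraticForm ℝ V) (hQ : ∀ x, Q x = -‖x‖ ^ 2)
    (A : V →ₗ[ℝ] V) (hA : ∀ x y, ⟪A x, y⟫ = ⟪x, A y⟫) (v : V) :
    ∑ i, CliffordAlgebra.ι Q (b i) * CliffordAlgebra.ι Q v * CliffordAlgebra.ι Q (A (b i)) =
      (LinearMap.trace ℝ V A) • CliffordAlgebra.ι Q v - 2 • CliffordAlgebra.ι Q (A v) := by
  have anticomm (i : Fin n) :
      CliffordAlgebra.ι Q (b i) * CliffordAlgebra.ι Q v * CliffordAlgebra.ι Q (A (b i)) =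
        (-2 : ℝ) • CliffordAlgebra.ι Q (A (⟪b i, v⟫ • b i)) -
          CliffordAlgebra.ι Q v * (CliffordAlgebra.ι Q (b i) * CliffordAlgebra.ι Q (A (b i))) := by
    rw [eq_sub_of_add_eq (ι_mul_ι_add_swap_eq_inner_smul hQ (b i) v), sub_mul, smul_mul_assoc,
      one_mul, mul_assoc, map_smul, map_smul, smul_smul]
  simp_rw [anticomm]
  rw [Finset.sum_sub_distrib, ← Finset.smul_sum, ← Finset.mul_sum,
    sum_ι_mul_ι_apply_symmetric hQ b A hA, ← map_sum, ← map_sum, b.sum_repr', mul_neg,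
    mul_smul_comm, mul_one]
  module
end

section
/- Let V be a finite-dimensional real inner product space, let Q be the quadratic form on V given by Q(x) = -‖x‖², and let M be a module over the Clifford algebra of Q which is also a real vector space with compatible scalar action (scalar tower). Let (e_1, …, e_n) be an orthonormal basis of V and let L : V → M be a real linear map satisfying the Dirac-type condition ∑_{i=1}^n ι(e_i) • L(e_i) = 0. If L is not identically zero, then the rank of L is at least 2; equivalently, L cannot have rank exactly 1. -/
/-- Clifford multiplication by an anisotropic vector is injective on a Clifford module. -/
theorem CliffordAlgebra.eq_zero_of_ι_smul_eq_zero {K V M : Type*} [Field K]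
    [AddCommGroup V] [Module K V] {Q : QuadraticForm K V} [AddCommGroup M] [Module K M]
    [Module (CliffordAlgebra Q) M] [IsScalarTower K (CliffordAlgebra Q) M]
    {x : V} (hx : Q x ≠ 0) {m : M} (h : CliffordAlgebra.ι Q x • m = 0) : m = 0 := by
  have hsq : Q x • m = 0 := by
    rw [← algebraMap_smul (CliffordAlgebra Q) (Q x) m, ← CliffordAlgebra.ι_sq_scalar,
      mul_smul, h, smul_zero]
  exact (smul_eq_zero.mp hsq).resolve_left hx

/-- If `L : V → M` is a linear map into a Clifford module satisfying the Dirac-type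
condition `∑ i, ι(e i) • L(e i) = 0` for an orthonormal basis `(e i)` (where
`Q(x) = -‖x‖²`), and `L` is not identically zero, then `L` has rank at least `2`. -/
theorem rank_ge_two_of_dirac_condition
    {V : Type*} [NormedAddCommGroup V] [InnerProductSpace ℝ V] [FiniteDimensional ℝ V]
    {n : ℕ} (b : OrthonormalBasis (Fin n) ℝ V)
    (Q : QuadraticForm ℝ V) (hQ : ∀ x, Q x = -‖x‖ ^ 2)
    {M : Type*} [AddCommGroup M] [Module ℝ M]
    [Module (CliffordAlgebra Q) M] [IsScalarTower ℝ (CliffordAlgebra Q) M]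
    (L : V →ₗ[ℝ] M)
    (hDirac : ∑ i, CliffordAlgebra.ι Q (b i) • L (b i) = 0)
    (hL : L ≠ 0) :
    2 ≤ Module.rank ℝ (LinearMap.range L) := by
  rw [Cardinal.two_le_iff_one_lt]
  by_contra! hle
  obtain ⟨m, hm⟩ := (rank_submodule_le_one_iff' _).mp hle
  have hspan (i : Fin n) : ∃ c : ℝ, c • m = L (b i) :=
    Submodule.mem_span_singleton.mp (hm (LinearMap.mem_range_self L (b i)))
  choose c hc using hspan
  have : SMulCommClass ℝ (CliffordAlgebra Q) M := IsScalarTower.to_smulCommClass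
  have hx : CliffordAlgebra.ι Q (∑ i, c i • b i) • m = 0 := by
    rw [← hDirac, map_sum, Finset.sum_smul]
    refine Finset.sum_congr rfl fun i _ => ?_
    rw [map_smul, smul_assoc, ← hc, smul_comm]
  refine hL (b.toBasis.ext fun i => ?_)
  rw [b.coe_toBasis, LinearMap.zero_apply, ← hc]
  by_cases h0 : ∑ i, c i • b i = 0
  · rw [Fintype.linearIndependent_iff.mp b.orthonormal.linearIndependent c h0 i, zero_smul]
  · have hQx : Q (∑ i, c i • b i) ≠ 0 := by
      rw [hQ]
      exact neg_ne_zero.mpr (pow_ne_zero 2 (norm_ne_zero_iff.mpr h0))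
    rw [CliffordAlgebra.eq_zero_of_ι_smul_eq_zero hQx hx, smul_zero]
end

section
/- Let n be a natural number, let g : ℝ → Matrix (Fin n) (Fin n) ℝ be a differentiable family of matrices such that g(t) is positive definite (in particular det g(t) > 0) for every t, and let W : ℝ → Matrix (Fin n) (Fin n) ℝ be a family of matrices such that the derivative of g satisfies deriv g t = -2 • (g t * W t) for all t. Then for every t₀, the function t ↦ √(det (g t)) has derivative -(trace (W t₀)) * √(det (g t₀)) at t₀. In words: if the first fundamental form evolves by ġ = -2 g W, then the Riemannian volume density v = √(det g) evolves by v̇ = -(tr W) v. -/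
/-- **Jacobi's formula** for the derivative of a determinant along a curve of matrices. -/
theorem HasDerivAt.matrix_det {ι : Type*} [Fintype ι] [DecidableEq ι]
    {A : ℝ → Matrix ι ι ℝ} {A' : Matrix ι ι ℝ} {t : ℝ} (hA : HasDerivAt A A' t) :
    HasDerivAt (fun s => (A s).det) (((A t).adjugate * A').trace) t := by
  let D : ContinuousMultilinearMap ℝ (fun _ : ι => ι → ℝ) ℝ :=
    ⟨(Matrix.detRowAlternating (n := ι) (R := ℝ)).toMultilinearMap,
      Continuous.matrix_det continuous_id⟩
  have hD : HasDerivAt (fun s => (A s).det) (D.linearDeriv (A t) A') t :=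
    (D.hasFDerivAt (A t)).comp_hasDerivAt t hA
  convert hD using 1
  refine Eq.trans ?_ (D.linearDeriv_apply (A t) A').symm
  rw [Matrix.trace_mul_comm]
  refine Finset.sum_congr rfl fun i _ => ?_
  change _ = ((A t).updateRow i (A' i)).det
  rw [← Matrix.cramer_transpose_apply, Matrix.cramer_eq_adjugate_mulVec,
    ← Matrix.adjugate_transpose, Matrix.mulVec_transpose]
  rfl

/-- If a differentiable family `g` of positive definite matrices evolves by
`ġ = -2 g W`, then the volume density `√(det g)` evolves by
`(√(det g))' = -(tr W) √(det g)`. -/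
theorem sqrt_det_evolution
    {n : ℕ} (g W : ℝ → Matrix (Fin n) (Fin n) ℝ)
    (hg : Differentiable ℝ g)
    (hpos : ∀ t, (g t).PosDef)
    (hevol : ∀ t, deriv g t = (-2 : ℝ) • (g t * W t)) :
    ∀ t₀, HasDerivAt (fun t => Real.sqrt ((g t).det))
      (-(W t₀).trace * Real.sqrt ((g t₀).det)) t₀ := by
  intro t₀
  have hdet : 0 < (g t₀).det := (hpos t₀).det_pos
  have hderiv : HasDerivAt g (deriv g t₀) t₀ :=
    DifferentiableAt.hasDerivAt (F := Fin n → Fin n → ℝ) (f := g) (hg t₀)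
  rw [hevol] at hderiv
  convert hderiv.matrix_det.sqrt hdet.ne' using 1
  rw [Matrix.mul_smul, ← Matrix.mul_assoc, Matrix.adjugate_mul, Matrix.smul_mul, Matrix.one_mul,
    Matrix.trace_smul, Matrix.trace_smul, smul_eq_mul, smul_eq_mul, eq_div_iff (by positivity)]
  linear_combination (-2 * (W t₀).trace) * Real.mul_self_sqrt hdet.le
end
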